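/- For every D, L > 0 the set X'_ν(D,L) is a compact subset of the metric space (X_ν, d₂): in particular it is closed, and every sequence in X'_ν(D,L) admits a d₂-convergent subsequence with limit in X'_ν(D,L). -/

import Mathlib

set_option autoImplicit false

open MeasureTheory Set Real Filter

noncomputable section

/-- The (topological) support of a measure: points all of whose open neighborhoods
have positive measure. -/
def msupp {E : Type*} [TopologicalSpace E] [MeasurableSpace E] (μ : Measure E) : Set E :=
  {z | ∀ U : Set E, IsOpen U → z ∈ U → μ U ≠ 0}

/-- `π` is a coupling of `μ` and `ν`. -/
def IsCoupling {E F : Type*} [MeasurableSpace E] [MeasurableSpace F]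
    (pl : Measure (E × F)) (μ : Measure E) (ν : Measure F) : Prop :=
  pl.map Prod.fst = μ ∧ pl.map Prod.snd = ν

/-- The 2-Wasserstein distance. -/
def W2 {E : Type*} [MeasurableSpace E] [PseudoMetricSpace E] (μ ν : Measure E) : ℝ :=
  ⨅ pl : {pl : Measure (E × E) // IsCoupling pl μ ν},
    Real.sqrt (∫ q, dist q.1 q.2 ^ 2 ∂(pl.1))

/-- The conditional pseudo-inverse cumulative distribution function
`F⁻¹_η(s) = inf {x | η(−∞,x] ≥ s}`. -/
def qf (η : Measure ℝ) (s : ℝ) : ℝ := sInf {x : ℝ | s ≤ (η (Iic x)).toReal}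

/-- Membership in `X_ν`: Markov kernels (represented as measurable families of
probability measures on `ℝ`) with finite second moments. -/
def MemXnu (p : ℝ → Measure ℝ) : Prop :=
  (∀ ω, IsProbabilityMeasure (p ω)) ∧
  (∀ A : Set ℝ, MeasurableSet A → Measurable fun ω => p ω A) ∧
  (∀ ω, Integrable (fun x : ℝ => x ^ 2) (p ω))

/-- The metric `d₂` on `X_ν`. -/
def d2 (ν : Measure ℝ) (p q : ℝ → Measure ℝ) : ℝ :=
  Real.sqrt (∫ ω, W2 (p ω) (q ω) ^ 2 ∂ν)

/-- The path `u ↦ (1−u) p₀ ⊕ u p₁` given by the displacement interpolation of the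
pseudo-inverse cumulative distribution functions:
`((1−u) p₀ ⊕ u p₁)(·,ω) = ((1−u) F⁻¹_{p₀}(·,ω) + u F⁻¹_{p₁}(·,ω))_♯ L` with `L`
Lebesgue measure on `(0,1)`. -/
def geod (p₀ p₁ : ℝ → Measure ℝ) (u : ℝ) : ℝ → Measure ℝ :=
  fun ω => Measure.map (fun s => (1 - u) * qf (p₀ ω) s + u * qf (p₁ ω) s)
    (volume.restrict (Ioo (0:ℝ) 1))

/-- Membership in `X'_ν(D,L)`. -/
def MemX' (ν : Measure ℝ) (D L : ℝ) (p : ℝ → Measure ℝ) : Prop :=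
  MemXnu p ∧
  (∫ ω, (∫ x, x ∂(p ω)) ∂ν) = 0 ∧
  (∀ ω ∈ msupp ν, ∀ ω' ∈ msupp ν, ∀ x ∈ msupp (p ω), ∀ x' ∈ msupp (p ω'),
    |x - x'| ≤ D) ∧
  (∀ ω ∈ msupp ν, ∀ ω' ∈ msupp ν, W2 (p ω) (p ω') ≤ L * |ω - ω'|)

open ProbabilityTheory
open scoped Topology NNReal ENNReal

/-- Lebesgue measure on the open unit interval. -/
abbrev unitLeb : Measure ℝ := volume.restrict (Ioo (0 : ℝ) 1)

instance : IsProbabilityMeasure unitLeb := ⟨by simp [unitLeb]⟩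

/-- The quantile function, set to zero outside of the open unit interval. -/
def quantile (μ : Measure ℝ) (s : ℝ) : ℝ := if s ∈ Ioo (0 : ℝ) 1 then qf μ s else 0

lemma qf_le_iff (μ : Measure ℝ) [IsProbabilityMeasure μ] {s : ℝ} (hs : s ∈ Ioo (0 : ℝ) 1)
    (x : ℝ) : qf μ s ≤ x ↔ s ≤ μ.real (Iic x) := by
  have hset : {x : ℝ | s ≤ (μ (Iic x)).toReal} = {x : ℝ | s ≤ cdf μ x} := by
    ext x; simp [cdf_eq_real, Measure.real]
  rw [qf, hset, ← cdf_eq_real]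
  have hbdd : BddBelow {x : ℝ | s ≤ cdf μ x} := by
    obtain ⟨b, hb⟩ := ((tendsto_cdf_atBot μ).eventually_lt_const hs.1).exists
    refine ⟨b, fun y hy => ?_⟩
    by_contra! h
    exact absurd ((monotone_cdf μ) h.le) (not_le.2 (hb.trans_le hy))
  have hne : {x : ℝ | s ≤ cdf μ x}.Nonempty := by
    obtain ⟨b, hb⟩ := ((tendsto_cdf_atTop μ).eventually_const_lt hs.2).exists
    exact ⟨b, hb.le⟩
  refine ⟨fun h => ?_, fun h => csInf_le hbdd h⟩
  have hr : Tendsto (cdf μ) (𝓝[>] x) (𝓝 (cdf μ x)) :=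
    ((cdf μ).right_continuous x).mono_left (nhdsWithin_mono _ Ioi_subset_Ici_self)
  refine ge_of_tendsto hr ?_
  filter_upwards [self_mem_nhdsWithin] with y hy
  obtain ⟨a, ha, hay⟩ := exists_lt_of_csInf_lt hne (h.trans_lt hy)
  exact le_trans ha (monotone_cdf μ hay.le)

lemma measurable_quantile_uncurry {p : ℝ → Measure ℝ} (hp : ∀ ω, IsProbabilityMeasure (p ω))
    (hm : ∀ A : Set ℝ, MeasurableSet A → Measurable fun ω => p ω A) :
    Measurable fun z : ℝ × ℝ => quantile (p z.1) z.2 := by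
  refine measurable_of_Iic fun x => ?_
  have hset : (fun z : ℝ × ℝ => quantile (p z.1) z.2) ⁻¹' Iic x =
      (Prod.snd ⁻¹' Ioo (0 : ℝ) 1 ∩ {z | z.2 ≤ (p z.1).real (Iic x)}) ∪
        ((Prod.snd ⁻¹' Ioo (0 : ℝ) 1)ᶜ ∩ {_z | 0 ≤ x}) := by
    ext z
    by_cases hz : z.2 ∈ Ioo (0 : ℝ) 1
    · have := hp z.1
      simpa [quantile, hz] using by simp [qf_le_iff (p z.1) hz, hz.1, hz.2]
    · rw [mem_Ioo] at hz
      simp [quantile, hz]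
  rw [hset]
  have h1 : MeasurableSet (Prod.snd ⁻¹' Ioo (0 : ℝ) 1 : Set (ℝ × ℝ)) :=
    measurable_snd measurableSet_Ioo
  refine (h1.inter (measurableSet_le measurable_snd ?_)).union (h1.compl.inter (.const _))
  exact ((hm _ measurableSet_Iic).comp measurable_fst).ennreal_toReal

lemma measurable_quantile (μ : Measure ℝ) [IsProbabilityMeasure μ] : Measurable (quantile μ) :=
  (measurable_quantile_uncurry (p := fun _ => μ) (fun _ => inferInstance)
    (fun _ _ => measurable_const)).comp (measurable_const.prodMk measurable_id :
      Measurable fun s : ℝ => ((0 : ℝ), s))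

lemma map_quantile (μ : Measure ℝ) [IsProbabilityMeasure μ] :
    unitLeb.map (quantile μ) = μ := by
  have := Measure.isProbabilityMeasure_map (μ := unitLeb) (measurable_quantile μ).aemeasurable
  refine Measure.ext_of_Iic _ _ fun x => ?_
  rw [Measure.map_apply (measurable_quantile μ) measurableSet_Iic,
    Measure.restrict_apply (measurable_quantile μ measurableSet_Iic)]
  have hset : quantile μ ⁻¹' Iic x ∩ Ioo 0 1 = Ioo 0 1 ∩ Iic (μ.real (Iic x)) := by
    ext s
    by_cases hs : s ∈ Ioo (0 : ℝ) 1
    · simp only [mem_inter_iff, mem_preimage, hs, mem_Iic, quantile, if_true,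
        qf_le_iff μ hs, true_and, and_true]
    · simp only [mem_inter_iff, hs, and_false, false_and]
  rw [hset]
  apply le_antisymm
  · calc volume (Ioo 0 1 ∩ Iic (μ.real (Iic x))) ≤ volume (Ioc 0 (μ.real (Iic x))) :=
          measure_mono fun s hs => ⟨hs.1.1, hs.2⟩
      _ = μ (Iic x) := by simp
  · calc μ (Iic x) = volume (Ioo 0 (μ.real (Iic x))) := by simp
      _ ≤ volume (Ioo 0 1 ∩ Iic (μ.real (Iic x))) :=
          measure_mono fun s hs => ⟨⟨hs.1, hs.2.trans_le measureReal_le_one⟩, hs.2.le⟩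

lemma memLp_quantile {μ : Measure ℝ} [IsProbabilityMeasure μ]
    (h : Integrable (fun x : ℝ => x ^ 2) μ) : MemLp (quantile μ) 2 unitLeb := by
  rw [memLp_two_iff_integrable_sq (measurable_quantile μ).aestronglyMeasurable]
  rw [← map_quantile μ] at h
  exact h.comp_measurable (measurable_quantile μ)

/-- The quantile function as an element of `L²(0,1)` (zero without finite second moment). -/
def quantileLp (μ : Measure ℝ) : Lp ℝ 2 unitLeb :=
  open Classical in if h : MemLp (quantile μ) 2 unitLeb then h.toLp else 0

lemma coeFn_quantileLp {μ : Measure ℝ} [IsProbabilityMeasure μ]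
    (h : Integrable (fun x : ℝ => x ^ 2) μ) : quantileLp μ =ᵐ[unitLeb] quantile μ := by
  rw [quantileLp, dif_pos (memLp_quantile h)]
  exact MemLp.coeFn_toLp _

/-- The law of an element of `L²(0,1)`. -/
def lawLp (h : Lp ℝ 2 unitLeb) : Measure ℝ := unitLeb.map h

lemma aemeasurable_Lp (h : Lp ℝ 2 unitLeb) : AEMeasurable h unitLeb :=
  (Lp.aestronglyMeasurable h).aemeasurable

instance (h : Lp ℝ 2 unitLeb) : IsProbabilityMeasure (lawLp h) :=
  Measure.isProbabilityMeasure_map (aemeasurable_Lp h)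

lemma integrable_sq_lawLp (h : Lp ℝ 2 unitLeb) : Integrable (fun x : ℝ => x ^ 2) (lawLp h) := by
  rw [lawLp, integrable_map_measure (by fun_prop) (aemeasurable_Lp h)]
  exact (memLp_two_iff_integrable_sq (Lp.aestronglyMeasurable h)).1 (Lp.memLp h)

lemma lawLp_quantileLp {μ : Measure ℝ} [IsProbabilityMeasure μ]
    (h : Integrable (fun x : ℝ => x ^ 2) μ) : lawLp (quantileLp μ) = μ := by
  rw [lawLp, Measure.map_congr (coeFn_quantileLp h), map_quantile]

/-- The quadruples `((x, y), (t, s))` with `y ≤ s ≤ t < x`. -/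
def orderedQuad : Set ((ℝ × ℝ) × (ℝ × ℝ)) := {z | z.1.2 ≤ z.2.2 ∧ z.2.2 ≤ z.2.1 ∧ z.2.1 < z.1.1}

lemma measurableSet_orderedQuad : MeasurableSet orderedQuad := by
  unfold orderedQuad
  measurability

lemma volume_orderedQuad_slice (q : ℝ × ℝ) :
    volume (Prod.mk q ⁻¹' orderedQuad) = ENNReal.ofReal (max (q.1 - q.2) 0 ^ 2 / 2) := by
  obtain ⟨x, y⟩ := q
  rw [Measure.volume_eq_prod, Measure.prod_apply (measurable_prodMk_left measurableSet_orderedQuad)]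
  have hslice : ∀ t : ℝ, volume (Prod.mk t ⁻¹' (Prod.mk (x, y) ⁻¹' orderedQuad)) =
      (Ioc y x).indicator (fun t => ENNReal.ofReal (t - y)) t ∨ t = x := by
    intro t
    rcases eq_or_ne t x with h | h
    · exact Or.inr h
    left
    have hset : Prod.mk t ⁻¹' (Prod.mk (x, y) ⁻¹' orderedQuad) = {s | y ≤ s ∧ s ≤ t ∧ t < x} := rfl
    rw [hset]
    by_cases htx : t < x
    · simp only [htx, and_true]
      change volume (Icc y t) = _
      rw [Real.volume_Icc]
      by_cases hy : y < t
      · rw [indicator_of_mem (show t ∈ Ioc y x from ⟨hy, htx.le⟩)]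
      · rw [indicator_of_notMem (fun h => hy h.1), ENNReal.ofReal_of_nonpos (by linarith)]
    · rw [indicator_of_notMem (fun h' => htx (lt_of_le_of_ne h'.2 h))]
      simp [htx]
  have hae : ∀ᵐ t : ℝ, volume (Prod.mk t ⁻¹' (Prod.mk (x, y) ⁻¹' orderedQuad)) =
      (Ioc y x).indicator (fun t => ENNReal.ofReal (t - y)) t := by
    filter_upwards [Measure.ae_ne volume x] with t ht
    exact (hslice t).resolve_right ht
  rw [lintegral_congr_ae hae, lintegral_indicator measurableSet_Ioc]
  rcases le_total x y with h | h
  · simp [h]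
  · rw [← ofReal_integral_eq_lintegral_ofReal, ← intervalIntegral.integral_of_le h,
      max_eq_left (sub_nonneg.2 h)]
    · congr 1
      rw [intervalIntegral.integral_sub (by simp) (by simp)]
      simp only [integral_id, intervalIntegral.integral_const, smul_eq_mul]
      ring
    · exact (intervalIntegrable_iff_integrableOn_Ioc_of_le h).1
        ((continuous_id.sub continuous_const).intervalIntegrable _ _)
    · filter_upwards [ae_restrict_mem measurableSet_Ioc] with t ht
      exact sub_nonneg.2 ht.1.le

lemma lintegral_max_sq_le {P Q : Measure (ℝ × ℝ)} [IsProbabilityMeasure P] [IsProbabilityMeasure Q]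
    (h : ∀ s t : ℝ, P {q | q.2 ≤ s ∧ t < q.1} ≤ Q {q | q.2 ≤ s ∧ t < q.1}) :
    ∫⁻ q, ENNReal.ofReal (max (q.1 - q.2) 0 ^ 2 / 2) ∂P ≤
      ∫⁻ q, ENNReal.ofReal (max (q.1 - q.2) 0 ^ 2 / 2) ∂Q := by
  simp_rw [← volume_orderedQuad_slice]
  rw [← Measure.prod_apply measurableSet_orderedQuad, ← Measure.prod_apply measurableSet_orderedQuad,
    Measure.prod_apply_symm measurableSet_orderedQuad,
    Measure.prod_apply_symm measurableSet_orderedQuad]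
  refine lintegral_mono fun w => ?_
  obtain ⟨t, s⟩ := w
  by_cases hst : s ≤ t
  · have hset : (fun q : ℝ × ℝ => (q, ((t, s) : ℝ × ℝ))) ⁻¹' orderedQuad =
        {q | q.2 ≤ s ∧ t < q.1} := by
      ext q; simp [orderedQuad, hst]
    rw [hset]
    exact h s t
  · have hset : (fun q : ℝ × ℝ => (q, ((t, s) : ℝ × ℝ))) ⁻¹' orderedQuad = ∅ := by
      ext q; simp [orderedQuad, hst]
    simp only [hset, measure_empty, le_refl]

lemma lintegral_sq_sub_eq (P : Measure (ℝ × ℝ)) :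
    ∫⁻ q, ENNReal.ofReal (dist q.1 q.2 ^ 2) ∂P =
      2 * (∫⁻ q, ENNReal.ofReal (max (q.1 - q.2) 0 ^ 2 / 2) ∂P +
        ∫⁻ q, ENNReal.ofReal (max (q.1 - q.2) 0 ^ 2 / 2) ∂(P.map Prod.swap)) := by
  rw [lintegral_map (by fun_prop) measurable_swap, ← lintegral_add_left (by fun_prop),
    ← lintegral_const_mul _ (by fun_prop)]
  refine lintegral_congr fun q => ?_
  rw [← ENNReal.ofReal_add (by positivity) (by positivity),
    ← ENNReal.ofReal_ofNat, ← ENNReal.ofReal_mul (by norm_num)]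
  congr 1
  simp only [Real.dist_eq, sq_abs, Prod.fst_swap, Prod.snd_swap]
  rcases le_total q.1 q.2 with h | h
  · rw [max_eq_right (by linarith), max_eq_left (by linarith)]; ring
  · rw [max_eq_left (by linarith), max_eq_right (by linarith)]; ring

lemma IsCoupling.isProbabilityMeasure {P : Measure (ℝ × ℝ)} {μ ν : Measure ℝ}
    [IsProbabilityMeasure μ] (h : IsCoupling P μ ν) : IsProbabilityMeasure P := by
  have : IsProbabilityMeasure (P.map Prod.fst) := h.1 ▸ inferInstance
  exact Measure.isProbabilityMeasure_of_map Prod.fst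

/-- The comonotone coupling. -/
def monotoneCoupling (μ ν : Measure ℝ) : Measure (ℝ × ℝ) :=
  unitLeb.map fun s => (quantile μ s, quantile ν s)

lemma measurable_quantile_pair (μ ν : Measure ℝ) [IsProbabilityMeasure μ] [IsProbabilityMeasure ν] :
    Measurable fun s => (quantile μ s, quantile ν s) :=
  (measurable_quantile μ).prodMk (measurable_quantile ν)

instance (μ ν : Measure ℝ) [IsProbabilityMeasure μ] [IsProbabilityMeasure ν] :
    IsProbabilityMeasure (monotoneCoupling μ ν) :=
  Measure.isProbabilityMeasure_map (measurable_quantile_pair μ ν).aemeasurable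

lemma monotoneCoupling_apply_le {P : Measure (ℝ × ℝ)} {μ ν : Measure ℝ}
    [IsProbabilityMeasure μ] [IsProbabilityMeasure ν] (h : IsCoupling P μ ν) (s t : ℝ) :
    monotoneCoupling μ ν {q | q.2 ≤ s ∧ t < q.1} ≤ P {q | q.2 ≤ s ∧ t < q.1} := by
  have := h.isProbabilityMeasure
  have hms : MeasurableSet {q : ℝ × ℝ | q.2 ≤ s ∧ t < q.1} := by
    measurability
  have hν : P {q | q.2 ≤ s} = ν (Iic s) := by
    rw [← h.2, Measure.map_apply measurable_snd measurableSet_Iic]; rfl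
  have hμ : P {q | q.1 ≤ t} = μ (Iic t) := by
    rw [← h.1, Measure.map_apply measurable_fst measurableSet_Iic]; rfl
  calc monotoneCoupling μ ν {q | q.2 ≤ s ∧ t < q.1}
      ≤ volume (Ioc (μ.real (Iic t)) (ν.real (Iic s))) := by
        rw [monotoneCoupling, Measure.map_apply (measurable_quantile_pair μ ν) hms,
          Measure.restrict_apply (measurable_quantile_pair μ ν hms)]
        refine measure_mono fun u hu => ?_
        obtain ⟨⟨hu1, hu2⟩, hu⟩ := hu
        simp only [quantile, hu, if_true] at hu1 hu2
        rw [← not_le, qf_le_iff μ hu, not_le] at hu2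
        exact ⟨hu2, (qf_le_iff ν hu s).1 hu1⟩
    _ = ν (Iic s) - μ (Iic t) := by
        rw [Real.volume_Ioc, ENNReal.ofReal_sub _ measureReal_nonneg, ofReal_measureReal,
          ofReal_measureReal]
    _ = P {q | q.2 ≤ s} - P {q | q.1 ≤ t} := by rw [hν, hμ]
    _ ≤ P ({q | q.2 ≤ s} \ {q | q.1 ≤ t}) := le_measure_sdiff
    _ = P {q | q.2 ≤ s ∧ t < q.1} := by
        congr 1; ext q; simp

lemma isCoupling_map {f g : ℝ → ℝ} (hf : AEMeasurable f unitLeb) (hg : AEMeasurable g unitLeb) :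
    IsCoupling (unitLeb.map fun s => (f s, g s)) (unitLeb.map f) (unitLeb.map g) :=
  ⟨AEMeasurable.map_map_of_aemeasurable measurable_fst.aemeasurable (hf.prodMk hg),
    AEMeasurable.map_map_of_aemeasurable measurable_snd.aemeasurable (hf.prodMk hg)⟩

lemma isCoupling_monotoneCoupling (μ ν : Measure ℝ) [IsProbabilityMeasure μ]
    [IsProbabilityMeasure ν] : IsCoupling (monotoneCoupling μ ν) μ ν := by
  have := isCoupling_map (measurable_quantile μ).aemeasurable (measurable_quantile ν).aemeasurable
  rwa [map_quantile, map_quantile] at this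

lemma lintegral_monotoneCoupling_le {P : Measure (ℝ × ℝ)} {μ ν : Measure ℝ}
    [IsProbabilityMeasure μ] [IsProbabilityMeasure ν] (h : IsCoupling P μ ν) :
    ∫⁻ q, ENNReal.ofReal (dist q.1 q.2 ^ 2) ∂(monotoneCoupling μ ν) ≤
      ∫⁻ q, ENNReal.ofReal (dist q.1 q.2 ^ 2) ∂P := by
  have := h.isProbabilityMeasure
  have hswap : IsCoupling (P.map Prod.swap) ν μ := by
    constructor
    · rw [Measure.map_map measurable_fst measurable_swap]; exact h.2
    · rw [Measure.map_map measurable_snd measurable_swap]; exact h.1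
  have := hswap.isProbabilityMeasure
  have hmon : (monotoneCoupling μ ν).map Prod.swap = monotoneCoupling ν μ := by
    rw [monotoneCoupling, Measure.map_map measurable_swap (measurable_quantile_pair μ ν)]; rfl
  rw [lintegral_sq_sub_eq, lintegral_sq_sub_eq, hmon]
  exact mul_le_mul_right (add_le_add (lintegral_max_sq_le (monotoneCoupling_apply_le h))
    (lintegral_max_sq_le (monotoneCoupling_apply_le hswap))) 2

lemma integrable_dist_sq {P : Measure (ℝ × ℝ)} {μ ν : Measure ℝ}
    (h : IsCoupling P μ ν) (hμ : Integrable (fun x : ℝ => x ^ 2) μ)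
    (hν : Integrable (fun x : ℝ => x ^ 2) ν) :
    Integrable (fun q : ℝ × ℝ => dist q.1 q.2 ^ 2) P := by
  rw [← h.1] at hμ
  rw [← h.2] at hν
  have h1 := hμ.comp_measurable measurable_fst
  have h2 := hν.comp_measurable measurable_snd
  refine ((h1.const_mul 2).add (h2.const_mul 2)).mono' (by fun_prop) (ae_of_all _ fun q => ?_)
  rw [Real.norm_of_nonneg (by positivity)]
  simp only [Real.dist_eq, sq_abs, Pi.add_apply, Function.comp_apply]
  nlinarith [sq_nonneg (q.1 + q.2)]

lemma W2_nonneg (μ ν : Measure ℝ) : 0 ≤ W2 μ ν := Real.iInf_nonneg fun _ => Real.sqrt_nonneg _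

lemma W2_le_of_isCoupling {P : Measure (ℝ × ℝ)} {μ ν : Measure ℝ} (h : IsCoupling P μ ν) :
    W2 μ ν ≤ √(∫ q, dist q.1 q.2 ^ 2 ∂P) :=
  ciInf_le (f := fun pl : {pl : Measure (ℝ × ℝ) // IsCoupling pl μ ν} =>
    √(∫ q, dist q.1 q.2 ^ 2 ∂(pl.1)))
    ⟨0, by rintro _ ⟨_, rfl⟩; exact Real.sqrt_nonneg _⟩ ⟨P, h⟩

lemma W2_eq_monotoneCoupling {μ ν : Measure ℝ} [IsProbabilityMeasure μ] [IsProbabilityMeasure ν]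
    (hμ : Integrable (fun x : ℝ => x ^ 2) μ) (hν : Integrable (fun x : ℝ => x ^ 2) ν) :
    W2 μ ν = √(∫ q, dist q.1 q.2 ^ 2 ∂(monotoneCoupling μ ν)) := by
  refine le_antisymm (W2_le_of_isCoupling (isCoupling_monotoneCoupling μ ν)) ?_
  have : Nonempty {pl : Measure (ℝ × ℝ) // IsCoupling pl μ ν} :=
    ⟨⟨_, isCoupling_monotoneCoupling μ ν⟩⟩
  refine le_ciInf fun ⟨P, hP⟩ => Real.sqrt_le_sqrt ?_
  rw [integral_eq_lintegral_of_nonneg_ae (ae_of_all _ fun _ => by positivity)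
      (by fun_prop),
    integral_eq_lintegral_of_nonneg_ae (ae_of_all _ fun _ => by positivity)
      (by fun_prop)]
  refine ENNReal.toReal_mono ?_ (lintegral_monotoneCoupling_le hP)
  exact ((hasFiniteIntegral_iff_ofReal (ae_of_all _ fun _ => by positivity)).1
    (integrable_dist_sq hP hμ hν).2).ne

lemma W2_eq_quantile {μ ν : Measure ℝ} [IsProbabilityMeasure μ] [IsProbabilityMeasure ν]
    (hμ : Integrable (fun x : ℝ => x ^ 2) μ) (hν : Integrable (fun x : ℝ => x ^ 2) ν) :
    W2 μ ν = √(∫ s, (quantile μ s - quantile ν s) ^ 2 ∂unitLeb) := by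
  rw [W2_eq_monotoneCoupling hμ hν, monotoneCoupling,
    integral_map (measurable_quantile_pair μ ν).aemeasurable (by fun_prop)]
  simp only [Real.dist_eq, sq_abs]

lemma dist_Lp_eq (g h : Lp ℝ 2 unitLeb) : dist g h = √(∫ s, (g s - h s) ^ 2 ∂unitLeb) := by
  rw [dist_eq_norm, eq_comm, Real.sqrt_eq_iff_mul_self_eq (integral_nonneg fun _ => by positivity)
    (norm_nonneg _), ← real_inner_self_eq_norm_mul_norm, L2.inner_def]
  refine integral_congr_ae ?_
  filter_upwards [Lp.coeFn_sub g h] with s hs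
  rw [hs]
  simp [sq]

lemma W2_eq_dist {μ ν : Measure ℝ} [IsProbabilityMeasure μ] [IsProbabilityMeasure ν]
    (hμ : Integrable (fun x : ℝ => x ^ 2) μ) (hν : Integrable (fun x : ℝ => x ^ 2) ν) :
    W2 μ ν = dist (quantileLp μ) (quantileLp ν) := by
  rw [W2_eq_quantile hμ hν, dist_Lp_eq]
  congr 1
  refine integral_congr_ae ?_
  filter_upwards [coeFn_quantileLp hμ, coeFn_quantileLp hν] with s h1 h2
  rw [h1, h2]

lemma W2_lawLp_le (g h : Lp ℝ 2 unitLeb) : W2 (lawLp g) (lawLp h) ≤ dist g h := by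
  have hc := isCoupling_map (aemeasurable_Lp g) (aemeasurable_Lp h)
  refine (W2_le_of_isCoupling hc).trans_eq ?_
  rw [dist_Lp_eq, integral_map ((aemeasurable_Lp g).prodMk (aemeasurable_Lp h)) (by fun_prop)]
  simp only [Real.dist_eq, sq_abs]

/-- **Helly's selection theorem** for uniformly bounded monotone functions. -/
lemma exists_subseq_ae_tendsto_of_monotone {R : ℝ} {f : ℕ → ℝ → ℝ} (hf : ∀ n, Monotone (f n))
    (hb : ∀ n s, f n s ∈ Icc (-R) R) :
    ∃ φ : ℕ → ℕ, StrictMono φ ∧ ∃ g : ℝ → ℝ, Monotone g ∧ (∀ s, g s ∈ Icc (-R) R) ∧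
      ∀ᵐ s : ℝ, Tendsto (fun k => f (φ k) s) atTop (𝓝 (g s)) := by
  have hK : IsCompact (Set.pi univ fun _ : ℚ => Icc (-R) R) :=
    isCompact_univ_pi fun _ => isCompact_Icc
  obtain ⟨l, -, φ, hφ, hl⟩ := hK.tendsto_subseq (x := fun n (r : ℚ) => f n r)
    fun n r _ => hb n r
  rw [tendsto_pi_nhds] at hl
  have hle : ∀ s, IsBoundedUnder (· ≤ ·) atTop fun k => f (φ k) s :=
    fun s => isBoundedUnder_of ⟨R, fun k => (hb _ s).2⟩
  have hge : ∀ s, IsBoundedUnder (· ≥ ·) atTop fun k => f (φ k) s :=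
    fun s => isBoundedUnder_of ⟨-R, fun k => (hb _ s).1⟩
  set g : ℝ → ℝ := fun s => limsup (fun k => f (φ k) s) atTop with hg
  have hgmono : Monotone g := fun s t hst =>
    limsup_le_limsup (Eventually.of_forall fun k => hf _ hst) (hge s).isCoboundedUnder_le (hle t)
  have hgl : ∀ r : ℚ, g r = l r := fun r => (hl r).limsup_eq
  refine ⟨φ, hφ, g, hgmono, fun s => ⟨?_, ?_⟩, ?_⟩
  · exact le_limsup_of_frequently_le (Frequently.of_forall fun k => (hb _ s).1) (hle s)
  · exact limsup_le_of_le (hge s).isCoboundedUnder_le (Eventually.of_forall fun k => (hb _ s).2)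
  have hae : ∀ᵐ s : ℝ, ContinuousAt g s := by
    have := hgmono.countable_not_continuousAt.ae_notMem volume
    filter_upwards [this] with s hs
    simpa using hs
  filter_upwards [hae] with s hs
  refine tendsto_order.2 ⟨fun a ha => ?_, fun b hb' => ?_⟩
  · obtain ⟨s', hs's, has'⟩ : ∃ s' < s, a < g s' :=
      ((hs.tendsto.eventually_const_lt ha).filter_mono nhdsWithin_le_nhds |>.and
        (self_mem_nhdsWithin : Iio s ∈ 𝓝[<] s)).exists.imp fun _ h => ⟨h.2, h.1⟩
    obtain ⟨r, hr1, hr2⟩ := exists_rat_btwn hs's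
    have har : a < l r := has'.trans_le ((hgmono hr1.le).trans_eq (hgl r))
    filter_upwards [(hl r).eventually_const_lt har] with k hk
    exact lt_of_lt_of_le hk (hf _ hr2.le)
  · obtain ⟨s', hs's, has'⟩ : ∃ s' > s, g s' < b :=
      ((hs.tendsto.eventually_lt_const hb').filter_mono nhdsWithin_le_nhds |>.and
        (self_mem_nhdsWithin : Ioi s ∈ 𝓝[>] s)).exists.imp fun _ h => ⟨h.2, h.1⟩
    obtain ⟨r, hr1, hr2⟩ := exists_rat_btwn hs's
    have har : l r < b := ((hgl r).symm.trans_le (hgmono hr2.le)).trans_lt has'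
    filter_upwards [(hl r).eventually_lt_const har] with k hk
    exact lt_of_le_of_lt (hf _ hr1.le) hk

/-- Elements of `L²(0,1)` with a monotone representative valued in `[-R, R]`. -/
def monotoneLp (R : ℝ) : Set (Lp ℝ 2 unitLeb) :=
  {h | ∃ g : ℝ → ℝ, Monotone g ∧ (∀ s, g s ∈ Icc (-R) R) ∧ h =ᵐ[unitLeb] g}

lemma isCompact_monotoneLp (R : ℝ) : IsCompact (monotoneLp R) := by
  refine IsSeqCompact.isCompact fun h hh => ?_
  choose f hf hb hfh using hh
  obtain ⟨φ, hφ, g, hg, hgb, hlim⟩ := exists_subseq_ae_tendsto_of_monotone hf hb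
  have hgL : MemLp g 2 unitLeb :=
    MemLp.of_bound hg.measurable.aestronglyMeasurable R (ae_of_all _ fun s => abs_le.2 (hgb s))
  refine ⟨hgL.toLp, ⟨g, hg, hgb, hgL.coeFn_toLp⟩, φ, hφ, ?_⟩
  rw [tendsto_iff_dist_tendsto_zero]
  simp only [Function.comp_apply, dist_Lp_eq]
  rw [← Real.sqrt_zero]
  refine (Real.continuous_sqrt.tendsto 0).comp ?_
  rw [← integral_zero ℝ ℝ (μ := unitLeb)]
  refine tendsto_integral_of_dominated_convergence (fun _ => (2 * R) ^ 2) (fun k => ?_)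
    (integrable_const _) (fun k => ?_) ?_
  · exact ((aemeasurable_Lp _).sub (aemeasurable_Lp _)).pow_const 2 |>.aestronglyMeasurable
  · filter_upwards [hfh (φ k), hgL.coeFn_toLp] with s h1 h2
    rw [h1, h2, Real.norm_of_nonneg (by positivity)]
    have h3 := hb (φ k) s
    have h4 := hgb s
    exact sq_le_sq' (by linarith [h3.1, h4.2]) (by linarith [h3.2, h4.1])
  · filter_upwards [ae_all_iff.2 hfh, hgL.coeFn_toLp, ae_restrict_of_ae hlim] with s h1 h2 h3
    simp only [h1, h2]
    simpa using (h3.sub_const (g s)).pow 2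

lemma quantileLp_mem_monotoneLp {μ : Measure ℝ} [IsProbabilityMeasure μ] {R : ℝ} (hR : 0 ≤ R)
    (h2 : Integrable (fun x : ℝ => x ^ 2) μ) (h : ∀ᵐ x ∂μ, x ∈ Icc (-R) R) :
    quantileLp μ ∈ monotoneLp R := by
  have hle : ∀ s ∈ Ioo (0 : ℝ) 1, qf μ s ≤ R := fun s hs => by
    have : μ (Iic R) = 1 := (mem_ae_iff_prob_eq_one measurableSet_Iic).1
      (h.mono fun x hx => hx.2)
    rw [qf_le_iff μ hs, Measure.real, this]
    exact hs.2.le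
  have hge : ∀ s ∈ Ioo (0 : ℝ) 1, -R ≤ qf μ s := fun s hs => by
    by_contra! hlt
    have hsub : Iic (qf μ s) ⊆ {x | ¬ x ∈ Icc (-R) R} := fun x hx hx' =>
      absurd (hx'.1.trans hx) (not_le.2 hlt)
    have h0 : μ (Iic (qf μ s)) = 0 := measure_mono_null hsub (ae_iff.1 h)
    have := (qf_le_iff μ hs _).1 le_rfl
    rw [Measure.real, h0] at this
    exact absurd this (not_le.2 hs.1)
  have hmono : ∀ s ∈ Ioo (0 : ℝ) 1, ∀ t ∈ Ioo (0 : ℝ) 1, s ≤ t → qf μ s ≤ qf μ t :=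
    fun s hs t ht hst => (qf_le_iff μ hs _).2 (hst.trans ((qf_le_iff μ ht _).1 le_rfl))
  refine ⟨fun s => if s ≤ 0 then -R else if s < 1 then qf μ s else R, fun s t hst => ?_,
    fun s => ?_, ?_⟩
  · dsimp only
    split_ifs with h1 h2 h3 h4 h5 h6 h7 h8
    any_goals linarith
    · exact hge t ⟨not_le.1 h2, h3⟩
    · exact hmono s ⟨not_le.1 h1, by assumption⟩ t ⟨by linarith, by assumption⟩ hst
    · exact hle s ⟨not_le.1 h1, by assumption⟩
  · dsimp only
    split_ifs with h1 h2
    · exact ⟨le_rfl, by linarith⟩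
    · exact ⟨hge s ⟨not_le.1 h1, h2⟩, hle s ⟨not_le.1 h1, h2⟩⟩
    · exact ⟨by linarith, le_rfl⟩
  · filter_upwards [coeFn_quantileLp h2, ae_restrict_mem measurableSet_Ioo] with s hs hs'
    rw [hs, quantile, if_pos hs', if_neg (not_le.2 hs'.1), if_pos hs'.2]

lemma integral_abs_sub_le_dist (g h : Lp ℝ 2 unitLeb) :
    ∫ s, |g s - h s| ∂unitLeb ≤ dist g h := by
  have hL : MemLp (fun s => |g s - h s|) 2 unitLeb := ((Lp.memLp g).sub (Lp.memLp h)).abs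
  have hvar := variance_nonneg (fun s => |g s - h s|) unitLeb
  rw [variance_eq_sub hL] at hvar
  rw [dist_Lp_eq]
  refine Real.le_sqrt_of_sq_le ?_
  simpa [sq_abs] using hvar

lemma integrable_lawLp_of_lipschitz {φ : ℝ → ℝ} {C : ℝ≥0} (hφ : LipschitzWith C φ)
    (g : Lp ℝ 2 unitLeb) : Integrable φ (lawLp g) := by
  have hid : Integrable (fun x : ℝ => x) (lawLp g) :=
    ((memLp_two_iff_integrable_sq (by fun_prop)).2 (integrable_sq_lawLp g)).integrable one_le_two
  have hmul : Integrable (fun x : ℝ => C * |x|) (lawLp g) := hid.abs.const_mul _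
  refine ((integrable_const |φ 0|).add hmul).mono'
    hφ.continuous.aestronglyMeasurable (ae_of_all _ fun x => ?_)
  have := hφ.dist_le_mul x 0
  simp only [Real.dist_eq, sub_zero] at this
  simp only [Pi.add_apply, Real.norm_eq_abs]
  linarith [abs_sub_abs_le_abs_sub (φ x) (φ 0)]

lemma abs_integral_lawLp_sub_le {φ : ℝ → ℝ} {C : ℝ≥0} (hφ : LipschitzWith C φ)
    (g h : Lp ℝ 2 unitLeb) :
    |∫ x, φ x ∂(lawLp g) - ∫ x, φ x ∂(lawLp h)| ≤ C * dist g h := by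
  have hm : ∀ u : Lp ℝ 2 unitLeb, Integrable (fun s => φ (u s)) unitLeb := fun u =>
    (integrable_lawLp_of_lipschitz hφ u).comp_aemeasurable (aemeasurable_Lp u)
  rw [lawLp, lawLp,
    integral_map (aemeasurable_Lp g) hφ.continuous.aestronglyMeasurable,
    integral_map (aemeasurable_Lp h) hφ.continuous.aestronglyMeasurable,
    ← integral_sub (hm g) (hm h)]
  refine (abs_integral_le_integral_abs).trans ?_
  calc ∫ s, |φ (g s) - φ (h s)| ∂unitLeb ≤ ∫ s, C * |g s - h s| ∂unitLeb := by
        refine integral_mono ((hm g).sub (hm h)).abs ?_ fun s => hφ.dist_le_mul _ _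
        exact (((Lp.memLp g).sub (Lp.memLp h)).integrable one_le_two).abs.const_mul _
    _ = C * ∫ s, |g s - h s| ∂unitLeb := integral_const_mul _ _
    _ ≤ C * dist g h := by gcongr; exact integral_abs_sub_le_dist g h

lemma lipschitzWith_integral_lawLp {φ : ℝ → ℝ} {C : ℝ≥0} (hφ : LipschitzWith C φ) :
    LipschitzWith C fun g : Lp ℝ 2 unitLeb => ∫ x, φ x ∂(lawLp g) :=
  LipschitzWith.of_dist_le_mul fun g h => abs_integral_lawLp_sub_le hφ g h

/-- A Lipschitz approximation from above of the indicator of `Iic x`. -/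
def iicApprox (x : ℝ) (n : ℕ) (y : ℝ) : ℝ := max 0 (1 - n * max 0 (y - x))

lemma lipschitzWith_iicApprox (x : ℝ) (n : ℕ) : LipschitzWith n (iicApprox x n) := by
  refine LipschitzWith.of_dist_le_mul fun y z => ?_
  simp only [Real.dist_eq, iicApprox, NNReal.coe_natCast]
  refine (abs_max_sub_max_le_max _ _ _ _).trans ?_
  rw [sub_self, abs_zero, max_eq_right (abs_nonneg _),
    show (1 - n * max 0 (y - x) - (1 - n * max 0 (z - x))) = n * (max 0 (z - x) - max 0 (y - x)) by
      ring, abs_mul, Nat.abs_cast]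
  refine mul_le_mul_of_nonneg_left ?_ n.cast_nonneg
  refine (abs_max_sub_max_le_max _ _ _ _).trans ?_
  rw [sub_self, abs_zero, max_eq_right (abs_nonneg _), abs_sub_comm y z, sub_sub_sub_cancel_right]

lemma tendsto_integral_iicApprox (μ : Measure ℝ) [IsProbabilityMeasure μ] (x : ℝ) :
    Tendsto (fun n => ∫ y, iicApprox x n y ∂μ) atTop (𝓝 (μ.real (Iic x))) := by
  rw [← integral_indicator_one measurableSet_Iic]
  refine tendsto_integral_of_dominated_convergence (fun _ => 1)
    (fun n => (lipschitzWith_iicApprox x n).continuous.aestronglyMeasurable) (integrable_const _)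
    (fun n => ae_of_all _ fun y => ?_) (ae_of_all _ fun y => ?_)
  · rw [iicApprox, Real.norm_of_nonneg (le_max_left _ _)]
    refine max_le zero_le_one (sub_le_self _ (by positivity))
  · by_cases hy : y ≤ x
    · have : ∀ n : ℕ, iicApprox x n y = 1 := fun n => by
        simp [iicApprox, max_eq_left (sub_nonpos.2 hy)]
      simp [this, hy]
    · rw [indicator_of_notMem (by simpa using hy)]
      have hyx : 0 < y - x := by linarith [not_le.1 hy]
      refine tendsto_const_nhds.congr' ?_
      filter_upwards [(tendsto_natCast_atTop_atTop (R := ℝ)).eventually_ge_atTop (1 / (y - x))]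
        with n hn
      rw [div_le_iff₀ hyx] at hn
      rw [iicApprox, max_eq_right hyx.le, max_eq_left (by linarith)]

lemma measurable_lawLp_apply {F : ℝ → Lp ℝ 2 unitLeb}
    (hF : ∀ Φ : Lp ℝ 2 unitLeb → ℝ, Continuous Φ → Measurable fun ω => Φ (F ω))
    (A : Set ℝ) (hA : MeasurableSet A) : Measurable fun ω => lawLp (F ω) A := by
  refine (Measure.measurable_coe hA).comp (Measurable.measure_of_isPiSystem_of_isProbabilityMeasure
    (μ := fun ω => lawLp (F ω)) (borel_eq_generateFrom_Iic ℝ ▸ BorelSpace.measurable_eq)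
    isPiSystem_Iic ?_)
  rintro _ ⟨x, rfl⟩
  have hreal : Measurable fun ω => (lawLp (F ω)).real (Iic x) :=
    measurable_of_tendsto_metrizable
      (fun n => hF _ (lipschitzWith_integral_lawLp (lipschitzWith_iicApprox x n)).continuous)
      (tendsto_pi_nhds.2 fun ω => tendsto_integral_iicApprox (lawLp (F ω)) x)
  simpa using hreal.ennreal_ofReal

lemma msupp_eq_support (μ : Measure ℝ) : msupp μ = μ.support := by
  ext x
  rw [Measure.support_eq_forall_isOpen]
  simp only [msupp, mem_ofPred_eq, pos_iff_ne_zero]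
  exact ⟨fun h U hx hU => h U hU hx, fun h U hU hx => h U hx hU⟩

lemma ae_mem_msupp (μ : Measure ℝ) : ∀ᵐ x ∂μ, x ∈ msupp μ := by
  rw [msupp_eq_support]; exact Measure.support_mem_ae

lemma nonempty_msupp (μ : Measure ℝ) [IsProbabilityMeasure μ] : (msupp μ).Nonempty :=
  (ae_mem_msupp μ).exists

lemma isClosed_msupp (μ : Measure ℝ) : IsClosed (msupp μ) := by
  rw [msupp_eq_support]; exact Measure.isClosed_support

lemma eventually_exists_mem_msupp_near {h : ℕ → Lp ℝ 2 unitLeb} {h' : Lp ℝ 2 unitLeb}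
    (hlim : Tendsto h atTop (𝓝 h')) {x : ℝ} (hx : x ∈ msupp (lawLp h')) {r : ℝ} (hr : 0 < r) :
    ∀ᶠ k in atTop, ∃ y ∈ msupp (lawLp (h k)), |x - y| < r := by
  set ψ : ℝ → ℝ := fun y => max 0 (r - dist y x) with hψ
  have hψL : LipschitzWith 1 ψ := by
    refine LipschitzWith.of_dist_le_mul fun y z => ?_
    simp only [hψ, NNReal.coe_one, one_mul, Real.dist_eq]
    refine (abs_max_sub_max_le_max _ _ _ _).trans ?_
    rw [sub_self, abs_zero, max_eq_right (abs_nonneg _), sub_sub_sub_cancel_left, abs_sub_comm y z]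
    refine (abs_abs_sub_abs_le_abs_sub _ _).trans_eq ?_
    rw [sub_sub_sub_cancel_right]
  have hψ0 : ∀ y, 0 ≤ ψ y := fun y => le_max_left _ _
  have hpos : 0 < ∫ y, ψ y ∂(lawLp h') := by
    rw [integral_pos_iff_support_of_nonneg hψ0 (integrable_lawLp_of_lipschitz hψL h')]
    refine (pos_iff_ne_zero.2 (hx _ Metric.isOpen_ball (Metric.mem_ball_self hr))).trans_le
      (measure_mono fun y hy => ?_)
    exact (lt_max_of_lt_right (sub_pos.2 (Metric.mem_ball.1 hy))).ne'
  have hcont := ((lipschitzWith_integral_lawLp hψL).continuous.tendsto h').comp hlim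
  filter_upwards [hcont.eventually_const_lt hpos] with k hk
  by_contra! hno
  refine hk.ne' (integral_eq_zero_of_ae ?_)
  filter_upwards [ae_mem_msupp (lawLp (h k))] with y hy
  have := hno y hy
  rw [abs_sub_comm] at this
  exact max_eq_left (sub_nonpos.2 this)

lemma MemXnu.measurable_W2 {p q : ℝ → Measure ℝ} (hp : MemXnu p) (hq : MemXnu q) :
    Measurable fun ω => W2 (p ω) (q ω) := by
  have heq : (fun ω => W2 (p ω) (q ω)) =
      fun ω => √(∫ s, (quantile (p ω) s - quantile (q ω) s) ^ 2 ∂unitLeb) := by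
    ext ω
    have := hp.1 ω
    have := hq.1 ω
    exact W2_eq_quantile (hp.2.2 ω) (hq.2.2 ω)
  rw [heq]
  have hm : StronglyMeasurable fun z : ℝ × ℝ => (quantile (p z.1) z.2 - quantile (q z.1) z.2) ^ 2 :=
    (((measurable_quantile_uncurry hp.1 hp.2.1).sub
      (measurable_quantile_uncurry hq.1 hq.2.1)).pow_const 2).stronglyMeasurable
  exact (StronglyMeasurable.integral_prod_right' (ν := unitLeb) hm).measurable.sqrt

lemma MemXnu.measurable_mean {p : ℝ → Measure ℝ} (hp : MemXnu p) :
    Measurable fun ω => ∫ x, x ∂(p ω) := by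
  have heq : (fun ω => ∫ x, x ∂(p ω)) = fun ω => ∫ s, quantile (p ω) s ∂unitLeb := by
    ext ω
    have := hp.1 ω
    conv_lhs => rw [← map_quantile (p ω)]
    exact integral_map (measurable_quantile _).aemeasurable (by fun_prop)
  rw [heq]
  exact (StronglyMeasurable.integral_prod_right' (ν := unitLeb)
    (measurable_quantile_uncurry hp.1 hp.2.1).stronglyMeasurable).measurable

lemma MemXnu.integrable_id {p : ℝ → Measure ℝ} (hp : MemXnu p) (ω : ℝ) :
    Integrable (fun x : ℝ => x) (p ω) := by
  have := hp.1 ω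
  exact ((memLp_two_iff_integrable_sq (by fun_prop)).2 (hp.2.2 ω)).integrable one_le_two

lemma MemX'.abs_sub_mean_le {ν : Measure ℝ} {D L : ℝ} {p : ℝ → Measure ℝ} (hp : MemX' ν D L p)
    {ω₀ ω : ℝ} (hω₀ : ω₀ ∈ msupp ν) (hω : ω ∈ msupp ν) {x : ℝ} (hx : x ∈ msupp (p ω₀)) :
    |x - ∫ y, y ∂(p ω)| ≤ D := by
  have := hp.1.1 ω
  have h1 : x - ∫ y, y ∂(p ω) = ∫ y, (x - y) ∂(p ω) := by
    rw [integral_sub (integrable_const _) (hp.1.integrable_id ω)]; simp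
  rw [h1, ← Real.norm_eq_abs]
  refine (norm_integral_le_of_norm_le_const (C := D) ?_).trans_eq (by simp)
  filter_upwards [ae_mem_msupp (p ω)] with y hy
  exact hp.2.2.1 ω₀ hω₀ ω hω x hx y hy

lemma MemX'.integrable_mean {ν : Measure ℝ} [IsProbabilityMeasure ν] {D L : ℝ}
    {p : ℝ → Measure ℝ} (hp : MemX' ν D L p) : Integrable (fun ω => ∫ x, x ∂(p ω)) ν := by
  obtain ⟨ω₀, hω₀⟩ := nonempty_msupp ν
  have := hp.1.1 ω₀
  obtain ⟨x, hx⟩ := nonempty_msupp (p ω₀)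
  refine Integrable.of_bound hp.1.measurable_mean.aestronglyMeasurable (|x| + D) ?_
  filter_upwards [ae_mem_msupp ν] with ω hω
  have h1 := hp.abs_sub_mean_le hω₀ hω hx
  have h2 := abs_sub_abs_le_abs_sub (∫ x, x ∂(p ω)) x
  rw [abs_sub_comm] at h1
  rw [Real.norm_eq_abs]
  linarith

lemma MemX'.ae_mem_Icc {ν : Measure ℝ} [IsProbabilityMeasure ν] {D L : ℝ} {p : ℝ → Measure ℝ}
    (hp : MemX' ν D L p) {ω : ℝ} (hω : ω ∈ msupp ν) : ∀ᵐ x ∂(p ω), x ∈ Icc (-D) D := by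
  filter_upwards [ae_mem_msupp (p ω)] with x hx
  have h1 : x = ∫ ω', (x - ∫ y, y ∂(p ω')) ∂ν := by
    rw [integral_sub (integrable_const _) hp.integrable_mean, hp.2.1]; simp
  rw [mem_Icc, ← abs_le, h1, ← Real.norm_eq_abs]
  refine (norm_integral_le_of_norm_le_const (C := D) ?_).trans_eq (by simp)
  filter_upwards [ae_mem_msupp ν] with ω' hω'
  exact hp.abs_sub_mean_le hω hω' hx

lemma MemXnu.W2_eq_dist {p q : ℝ → Measure ℝ} (hp : MemXnu p) (hq : MemXnu q) (ω ω' : ℝ) :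
    W2 (p ω) (q ω') = dist (quantileLp (p ω)) (quantileLp (q ω')) := by
  have := hp.1 ω
  have := hq.1 ω'
  exact _root_.W2_eq_dist (hp.2.2 ω) (hq.2.2 ω')

lemma MemXnu.lawLp_quantileLp {p : ℝ → Measure ℝ} (hp : MemXnu p) (ω : ℝ) :
    lawLp (quantileLp (p ω)) = p ω := by
  have := hp.1 ω
  exact _root_.lawLp_quantileLp (hp.2.2 ω)

/-- Uniform limits (in quantile coordinates) of elements of `X'_ν(D,L)` are in `X'_ν(D,L)`. -/
lemma memX'_of_uniform_limit {ν : Measure ℝ} [IsProbabilityMeasure ν] {D L : ℝ}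
    {pn : ℕ → ℝ → Measure ℝ} (hpn : ∀ n, MemX' ν D L (pn n)) {F : ℝ → Lp ℝ 2 unitLeb}
    (hF : ∀ Φ : Lp ℝ 2 unitLeb → ℝ, Continuous Φ → Measurable fun ω => Φ (F ω))
    {ε : ℕ → ℝ} (hε : Tendsto ε atTop (𝓝 0))
    (hdist : ∀ k, ∀ ω ∈ msupp ν, dist (quantileLp (pn k ω)) (F ω) ≤ ε k) :
    MemX' ν D L fun ω => lawLp (F ω) := by
  have hlim : ∀ ω ∈ msupp ν, Tendsto (fun k => quantileLp (pn k ω)) atTop (𝓝 (F ω)) :=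
    fun ω hω => tendsto_iff_dist_tendsto_zero.2
      (squeeze_zero (fun _ => dist_nonneg) (fun k => hdist k ω hω) hε)
  have hX : MemXnu fun ω => lawLp (F ω) :=
    ⟨fun ω => inferInstance, measurable_lawLp_apply hF, fun ω => integrable_sq_lawLp _⟩
  have hmean : ∀ k, ∀ ω ∈ msupp ν, |∫ x, x ∂(lawLp (F ω)) - ∫ x, x ∂(pn k ω)| ≤ ε k := by
    intro k ω hω
    have := abs_integral_lawLp_sub_le LipschitzWith.id (quantileLp (pn k ω)) (F ω)
    rw [(hpn k).1.lawLp_quantileLp, NNReal.coe_one, one_mul] at this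
    rw [abs_sub_comm]
    exact this.trans (hdist k ω hω)
  refine ⟨hX, ?_, fun ω hω ω' hω' x hx x' hx' => ?_, fun ω hω ω' hω' => ?_⟩
  · have hint : Integrable (fun ω => ∫ x, x ∂(lawLp (F ω))) ν := by
      refine ((integrable_const (ε 0)).add (hpn 0).integrable_mean.abs).mono'
        hX.measurable_mean.aestronglyMeasurable ?_
      filter_upwards [ae_mem_msupp ν] with ω hω
      have h1 := hmean 0 ω hω
      have h2 := abs_sub_abs_le_abs_sub (∫ x, x ∂(lawLp (F ω))) (∫ x, x ∂(pn 0 ω))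
      simp only [Real.norm_eq_abs, Pi.add_apply]
      linarith
    rw [← abs_eq_zero]
    refine le_antisymm (ge_of_tendsto' hε fun k => ?_) (abs_nonneg _)
    rw [← sub_zero (∫ ω, _ ∂ν), ← (hpn k).2.1, ← integral_sub hint (hpn k).integrable_mean,
      ← Real.norm_eq_abs]
    refine (norm_integral_le_of_norm_le_const (C := ε k) ?_).trans_eq (by simp)
    filter_upwards [ae_mem_msupp ν] with ω hω
    exact hmean k ω hω
  · refine le_of_forall_pos_le_add fun r hr => ?_
    obtain ⟨k, ⟨y, hy, hxy⟩, ⟨y', hy', hxy'⟩⟩ :=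
      ((eventually_exists_mem_msupp_near (hlim ω hω) hx (half_pos hr)).and
        (eventually_exists_mem_msupp_near (hlim ω' hω') hx' (half_pos hr))).exists
    rw [(hpn k).1.lawLp_quantileLp] at hy hy'
    have := abs_le.1 ((hpn k).2.2.1 ω hω ω' hω' y hy y' hy')
    have := abs_lt.1 hxy
    have := abs_lt.1 hxy'
    exact abs_le.2 ⟨by linarith, by linarith⟩
  · refine (W2_lawLp_le _ _).trans (le_of_tendsto' ((hlim ω hω).dist (hlim ω' hω')) fun k => ?_)
    rw [← (hpn k).1.W2_eq_dist (hpn k).1]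
    exact (hpn k).2.2.2 ω hω ω' hω'

/-- Arzelà–Ascoli for `X'_ν(D,L)`, uniformly on the support of `ν`. -/
lemma exists_subseq_uniform_limit {ν : Measure ℝ} [IsProbabilityMeasure ν]
    (hΩ : Bornology.IsBounded (msupp ν)) {D L : ℝ} (hD : 0 < D) (hL : 0 < L)
    {pn : ℕ → ℝ → Measure ℝ} (hpn : ∀ n, MemX' ν D L (pn n)) :
    ∃ φ : ℕ → ℕ, StrictMono φ ∧ ∃ q : ℝ → Measure ℝ, MemX' ν D L q ∧
      ∃ ε : ℕ → ℝ, Tendsto ε atTop (𝓝 0) ∧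
        ∀ k, ∀ ω ∈ msupp ν, W2 (pn (φ k) ω) (q ω) ≤ ε k := by
  classical
  have hK : IsCompact (msupp ν) := Metric.isCompact_of_isClosed_isBounded (isClosed_msupp ν) hΩ
  have : CompactSpace (msupp ν) := isCompact_iff_compactSpace.1 hK
  have hlip : ∀ n, LipschitzWith L.toNNReal fun ω : msupp ν => quantileLp (pn n ω) := fun n =>
    LipschitzWith.of_dist_le_mul fun ω ω' => by
      rw [← (hpn n).1.W2_eq_dist (hpn n).1, Real.coe_toNNReal _ hL.le]
      exact (hpn n).2.2.2 ω ω.2 ω' ω'.2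
  let u : ℕ → BoundedContinuousFunction (msupp ν) (Lp ℝ 2 unitLeb) := fun n =>
    BoundedContinuousFunction.mkOfCompact ⟨_, (hlip n).continuous⟩
  have hcompact : IsCompact (closure (range u)) := by
    refine BoundedContinuousFunction.arzela_ascoli (monotoneLp D) (isCompact_monotoneLp D) _ ?_ ?_
    · rintro _ ω ⟨n, rfl⟩
      have := (hpn n).1.1 ω
      exact quantileLp_mem_monotoneLp hD.le ((hpn n).1.2.2 ω) ((hpn n).ae_mem_Icc ω.2)
    · refine (LipschitzWith.uniformEquicontinuous _ L.toNNReal ?_).equicontinuous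
      rintro ⟨_, n, rfl⟩
      exact hlip n
  obtain ⟨f, -, φ, hφ, hf⟩ := hcompact.tendsto_subseq fun n => subset_closure (mem_range_self n)
  let F : ℝ → Lp ℝ 2 unitLeb := fun ω => if h : ω ∈ msupp ν then f ⟨ω, h⟩ else 0
  have hFK : ∀ ω (hω : ω ∈ msupp ν), F ω = f ⟨ω, hω⟩ := fun ω hω => dif_pos hω
  have hF : ∀ Φ : Lp ℝ 2 unitLeb → ℝ, Continuous Φ → Measurable fun ω => Φ (F ω) := by
    intro Φ hΦ
    have heq : (fun ω => Φ (F ω)) = (msupp ν).piecewise (fun ω => Φ (F ω)) fun _ => Φ 0 := by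
      ext ω
      by_cases hω : ω ∈ msupp ν
      · rw [piecewise_eq_of_mem _ _ _ hω]
      · rw [piecewise_eq_of_notMem _ _ _ hω]; simp [F, hω]
    rw [heq]
    refine ContinuousOn.measurable_piecewise ?_ continuousOn_const (isClosed_msupp ν).measurableSet
    rw [continuousOn_iff_continuous_domRestrict]
    convert hΦ.comp f.continuous using 1
    ext ω
    simp [hFK]
  have hε : Tendsto (fun k => dist (u (φ k)) f) atTop (𝓝 0) := tendsto_iff_dist_tendsto_zero.1 hf
  have hdist : ∀ k, ∀ ω ∈ msupp ν,
      dist (quantileLp (pn (φ k) ω)) (F ω) ≤ dist (u (φ k)) f := fun k ω hω => by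
    rw [hFK ω hω]
    exact BoundedContinuousFunction.dist_coe_le_dist (f := u (φ k)) (g := f) ⟨ω, hω⟩
  refine ⟨φ, hφ, fun ω => lawLp (F ω), memX'_of_uniform_limit (fun k => hpn (φ k)) hF hε hdist,
    _, hε, fun k ω hω => ?_⟩
  refine le_trans ?_ (hdist k ω hω)
  have := W2_lawLp_le (quantileLp (pn (φ k) ω)) (F ω)
  rwa [(hpn (φ k)).1.lawLp_quantileLp] at this

lemma d2_le_of_W2_le {ν : Measure ℝ} [IsProbabilityMeasure ν] {p q : ℝ → Measure ℝ} {ε : ℝ}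
    (h : ∀ ω ∈ msupp ν, W2 (p ω) (q ω) ≤ ε) : d2 ν p q ≤ ε := by
  obtain ⟨ω₀, hω₀⟩ := nonempty_msupp ν
  refine Real.sqrt_le_iff.2 ⟨(W2_nonneg _ _).trans (h ω₀ hω₀), (le_abs_self _).trans ?_⟩
  rw [← Real.norm_eq_abs]
  refine (norm_integral_le_of_norm_le_const (C := ε ^ 2) ?_).trans_eq (by simp)
  filter_upwards [ae_mem_msupp ν] with ω hω
  rw [Real.norm_of_nonneg (by positivity)]
  exact pow_le_pow_left₀ (W2_nonneg _ _) (h ω hω) 2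

lemma d2_eq_zero_of_tendsto {ν : Measure ℝ} [IsProbabilityMeasure ν] {p q : ℝ → Measure ℝ}
    (hp : MemXnu p) (hq : MemXnu q) {pn : ℕ → ℝ → Measure ℝ} (hpn : ∀ n, MemXnu (pn n))
    (hlim : Tendsto (fun n => d2 ν (pn n) p) atTop (𝓝 0)) {ε : ℕ → ℝ}
    (hε : Tendsto ε atTop (𝓝 0)) (hle : ∀ k, ∀ ω ∈ msupp ν, W2 (pn k ω) (q ω) ≤ ε k) :
    d2 ν p q = 0 := by
  by_cases hint : Integrable (fun ω => W2 (p ω) (q ω) ^ 2) ν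
  swap
  · rw [d2, integral_undef hint, Real.sqrt_zero]
  have htri : ∀ k, ∀ ω ∈ msupp ν, W2 (p ω) (q ω) ≤ W2 (pn k ω) (p ω) + ε k ∧
      W2 (pn k ω) (p ω) ≤ W2 (p ω) (q ω) + ε k := by
    intro k ω hω
    have h := hle k ω hω
    rw [(hpn k).W2_eq_dist hq] at h
    rw [hp.W2_eq_dist hq, (hpn k).W2_eq_dist hp]
    constructor
    · linarith [dist_triangle_left (quantileLp (p ω)) (quantileLp (q ω)) (quantileLp (pn k ω))]
    · linarith [dist_triangle_right (quantileLp (pn k ω)) (quantileLp (p ω)) (quantileLp (q ω))]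
  have hintk : ∀ k, Integrable (fun ω => W2 (pn k ω) (p ω) ^ 2) ν := fun k => by
    refine ((hint.const_mul 2).add (integrable_const (2 * ε k ^ 2))).mono'
      (((hpn k).measurable_W2 hp).pow_const 2).aestronglyMeasurable ?_
    filter_upwards [ae_mem_msupp ν] with ω hω
    rw [Real.norm_of_nonneg (by positivity)]
    have h1 := pow_le_pow_left₀ (W2_nonneg _ _) (htri k ω hω).2 2
    simp only [Pi.add_apply]
    linarith [sq_nonneg (W2 (p ω) (q ω) - ε k)]
  have hbound : ∀ k, ∫ ω, W2 (p ω) (q ω) ^ 2 ∂ν ≤ 2 * d2 ν (pn k) p ^ 2 + 2 * ε k ^ 2 := by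
    intro k
    rw [d2, Real.sq_sqrt (integral_nonneg fun _ => by positivity), ← integral_const_mul]
    calc ∫ ω, W2 (p ω) (q ω) ^ 2 ∂ν ≤ ∫ ω, (2 * W2 (pn k ω) (p ω) ^ 2 + 2 * ε k ^ 2) ∂ν := by
          refine integral_mono_ae hint (((hintk k).const_mul 2).add (integrable_const _)) ?_
          filter_upwards [ae_mem_msupp ν] with ω hω
          have h1 := pow_le_pow_left₀ (W2_nonneg _ _) (htri k ω hω).1 2
          linarith [sq_nonneg (W2 (pn k ω) (p ω) - ε k)]
      _ = _ := by
          rw [integral_add ((hintk k).const_mul 2) (integrable_const _)]; simp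
  have hz : Tendsto (fun k => 2 * d2 ν (pn k) p ^ 2 + 2 * ε k ^ 2) atTop (𝓝 0) := by
    simpa using ((hlim.pow 2).const_mul 2).add ((hε.pow 2).const_mul 2)
  exact Real.sqrt_eq_zero_of_nonpos (ge_of_tendsto' hz hbound)

/-- For every `D, L > 0` the set `X'_ν(D,L)` is a compact subset of the
metric space `(X_ν, d₂)`: it is closed (modulo the identification of kernels at
`d₂`-distance zero), and every sequence in `X'_ν(D,L)` admits a `d₂`-convergent
subsequence with limit in `X'_ν(D,L)`. -/
theorem Xnu_prime_compact
    (ν : Measure ℝ) [IsProbabilityMeasure ν]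
    (hν2 : Integrable (fun x : ℝ => x ^ 2) ν)
    (hΩ : Bornology.IsBounded (msupp ν))
    (D L : ℝ) (hD : 0 < D) (hL : 0 < L) :
    (∀ p : ℝ → Measure ℝ, MemXnu p →
      ∀ pn : ℕ → ℝ → Measure ℝ, (∀ n, MemX' ν D L (pn n)) →
      Tendsto (fun n => d2 ν (pn n) p) atTop (nhds 0) →
      ∃ q : ℝ → Measure ℝ, MemX' ν D L q ∧ d2 ν p q = 0) ∧
    (∀ pn : ℕ → ℝ → Measure ℝ, (∀ n, MemX' ν D L (pn n)) →
      ∃ φ : ℕ → ℕ, StrictMono φ ∧ ∃ q : ℝ → Measure ℝ, MemX' ν D L q ∧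
        Tendsto (fun k => d2 ν (pn (φ k)) q) atTop (nhds 0)) := by
  refine ⟨fun p hp pn hpn hlim => ?_, fun pn hpn => ?_⟩
  · obtain ⟨φ, hφ, q, hq, ε, hε, hle⟩ := exists_subseq_uniform_limit hΩ hD hL hpn
    exact ⟨q, hq, d2_eq_zero_of_tendsto hp hq.1 (fun k => (hpn (φ k)).1)
      (hlim.comp hφ.tendsto_atTop) hε hle⟩
  · obtain ⟨φ, hφ, q, hq, ε, hε, hle⟩ := exists_subseq_uniform_limit hΩ hD hL hpn
    exact ⟨φ, hφ, q, hq, squeeze_zero (fun _ => Real.sqrt_nonneg _)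
      (fun k => d2_le_of_W2_le (hle k)) hε⟩
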